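/- Main semi-discrete convergence theorem (Theorem 4.2): there exist constants R > 0, τ₀ > 0, r > 0 and C > 0 such that for all τ ∈ (0, τ₀] the following holds. Let (ψ_n)_{n≥0} and (ψ*_n)_{n≥0} be sequences of even functions ℝ → ℝ such that each ψ_n is differentiable with ψ_n, ψ_n' square-integrable and ∫_ℝ ψ_n² = 1, each ψ*_n is twice differentiable with ψ*_n, (ψ*_n)', (ψ*_n)'' square-integrable, ψ*_n = ψ_n + τ·( (1/2)·(ψ*_n)'' + ψ_n²·ψ*_n ) pointwise, ‖ψ*_n‖_{L²} > 0 and ψ_{n+1} = ψ*_n/‖ψ*_n‖_{L²}. If ‖ψ₀ − η‖_{H¹} ≤ R, then for all n ≥ 0, ‖ψ_n − η‖_{H¹} ≤ C·e^{−r·n·τ}. -/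

import Mathlib

open MeasureTheory

/-- The ground state `η(x) = (1/2) sech(x/2)`. -/
noncomputable def eta (x : ℝ) : ℝ := (1/2) * (1 / Real.cosh (x/2))

/-- Squared `H¹` norm: `‖f‖_{H¹}² = ∫ (f² + f'²)`. -/
noncomputable def H1sq (f : ℝ → ℝ) : ℝ := ∫ x : ℝ, ((f x)^2 + (deriv f x)^2)

open Filter Topology

/-- `f` is everywhere differentiable with derivative `f'`, and both are square-integrable. -/
structure MemH1 (f f' : ℝ → ℝ) : Prop where
  hasDerivAt : ∀ x, HasDerivAt f (f' x) x
  sq : Integrable (fun x => f x ^ 2)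
  deriv_sq : Integrable (fun x => f' x ^ 2)

theorem integrable_mul_of_sq {f g : ℝ → ℝ} (hf : Measurable f) (hg : Measurable g)
    (hf2 : Integrable (fun x => f x ^ 2)) (hg2 : Integrable (fun x => g x ^ 2)) :
    Integrable (fun x => f x * g x) := by
  refine (hf2.add hg2).mono' (hf.mul hg).aestronglyMeasurable (ae_of_all _ fun x => ?_)
  rw [Real.norm_eq_abs, abs_le]
  constructor <;> simp only [Pi.add_apply] <;>
    nlinarith [sq_nonneg (f x + g x), sq_nonneg (f x - g x)]

theorem integrable_sq_of_le {f g : ℝ → ℝ} {C : ℝ} (hf : Measurable f)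
    (hg : Integrable (fun x => g x ^ 2)) (h : ∀ x, f x ^ 2 ≤ C * g x ^ 2) :
    Integrable (fun x => f x ^ 2) := by
  refine (hg.const_mul C).mono' (hf.pow_const 2).aestronglyMeasurable (ae_of_all _ fun x => ?_)
  rw [Real.norm_eq_abs, abs_of_nonneg (sq_nonneg _)]
  exact h x

namespace MemH1

variable {f f' g g' : ℝ → ℝ}

theorem deriv_eq (hf : MemH1 f f') : deriv f = f' := funext fun x => (hf.hasDerivAt x).deriv

theorem differentiable (hf : MemH1 f f') : Differentiable ℝ f :=
  fun x => (hf.hasDerivAt x).differentiableAt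

theorem continuous (hf : MemH1 f f') : Continuous f := hf.differentiable.continuous

theorem measurable (hf : MemH1 f f') : Measurable f := hf.continuous.measurable

theorem measurable_deriv (hf : MemH1 f f') : Measurable f' := by
  rw [← hf.deriv_eq]; exact _root_.measurable_deriv f

theorem integrable_mul (hf : MemH1 f f') (hg : MemH1 g g') : Integrable (fun x => f x * g x) :=
  integrable_mul_of_sq hf.measurable hg.measurable hf.sq hg.sq

theorem integrable_mul_deriv (hf : MemH1 f f') (hg : MemH1 g g') :
    Integrable (fun x => f x * g' x) :=
  integrable_mul_of_sq hf.measurable hg.measurable_deriv hf.sq hg.deriv_sq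

theorem integrable_deriv_mul (hf : MemH1 f f') (hg : MemH1 g g') :
    Integrable (fun x => f' x * g x) :=
  integrable_mul_of_sq hf.measurable_deriv hg.measurable hf.deriv_sq hg.sq

theorem integrable_deriv_mul_deriv (hf : MemH1 f f') (hg : MemH1 g g') :
    Integrable (fun x => f' x * g' x) :=
  integrable_mul_of_sq hf.measurable_deriv hg.measurable_deriv hf.deriv_sq hg.deriv_sq

theorem integral_deriv_mul_add_eq_zero (hf : MemH1 f f') (hg : MemH1 g g') :
    ∫ x, (f' x * g x + f x * g' x) = 0 :=
  integral_eq_zero_of_hasDerivAt_of_integrable (f := fun x => f x * g x)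
    (fun x => (hf.hasDerivAt x).mul (hg.hasDerivAt x))
    ((hf.integrable_deriv_mul hg).add (hf.integrable_mul_deriv hg)) (hf.integrable_mul hg)

theorem const_mul (hf : MemH1 f f') (c : ℝ) : MemH1 (fun x => c * f x) (fun x => c * f' x) where
  hasDerivAt x := (hf.hasDerivAt x).const_mul c
  sq := by simpa only [mul_pow] using hf.sq.const_mul (c ^ 2)
  deriv_sq := by simpa only [mul_pow] using hf.deriv_sq.const_mul (c ^ 2)

theorem sub (hf : MemH1 f f') (hg : MemH1 g g') :
    MemH1 (fun x => f x - g x) (fun x => f' x - g' x) where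
  hasDerivAt x := (hf.hasDerivAt x).sub (hg.hasDerivAt x)
  sq := by
    have h := (hf.sq.sub ((hf.integrable_mul hg).const_mul 2)).add hg.sq
    refine h.congr (ae_of_all _ fun x => ?_)
    simp only [Pi.add_apply, Pi.sub_apply]
    ring
  deriv_sq := by
    have h := (hf.deriv_sq.sub ((hf.integrable_deriv_mul_deriv hg).const_mul 2)).add hg.deriv_sq
    refine h.congr (ae_of_all _ fun x => ?_)
    simp only [Pi.add_apply, Pi.sub_apply]
    ring

/-- The one-dimensional Sobolev embedding `H¹ ⊂ L^∞`. -/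
theorem sq_le_integral (hf : MemH1 f f') (x : ℝ) : f x ^ 2 ≤ ∫ y, (f y ^ 2 + f' y ^ 2) := by
  have hd : ∀ y, HasDerivAt (fun y => f y ^ 2) (2 * (f y * f' y)) y := fun y => by
    have := (hf.hasDerivAt y).pow 2
    refine this.congr_deriv ?_
    push_cast
    ring
  have hi : Integrable (fun y => 2 * (f y * f' y)) := (hf.integrable_mul_deriv hf).const_mul 2
  have ht : Tendsto (fun y => f y ^ 2) atBot (𝓝 0) :=
    tendsto_zero_of_hasDerivAt_of_integrableOn_Iic (a := 0) (fun y _ => hd y) hi.integrableOn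
      hf.sq.integrableOn
  have h1 := integral_Iic_of_hasDerivAt_of_tendsto' (a := x) (fun y _ => hd y) hi.integrableOn ht
  have h2 : Integrable (fun y => f y ^ 2 + f' y ^ 2) := hf.sq.add hf.deriv_sq
  calc f x ^ 2 = ∫ y in Set.Iic x, 2 * (f y * f' y) := by rw [h1, sub_zero]
    _ ≤ ∫ y in Set.Iic x, (f y ^ 2 + f' y ^ 2) := by
      refine integral_mono hi.integrableOn h2.integrableOn fun y => ?_
      nlinarith [sq_nonneg (f y - f' y)]
    _ ≤ ∫ y, (f y ^ 2 + f' y ^ 2) :=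
      setIntegral_le_integral h2 (ae_of_all _ fun y => by positivity)

theorem tendsto_atTop (hf : MemH1 f f') : Tendsto f atTop (𝓝 0) := by
  have hd : ∀ y, HasDerivAt (fun y => f y ^ 2) (2 * (f y * f' y)) y := fun y => by
    have := (hf.hasDerivAt y).pow 2
    refine this.congr_deriv ?_
    push_cast
    ring
  have ht : Tendsto (fun y => f y ^ 2) atTop (𝓝 0) :=
    tendsto_zero_of_hasDerivAt_of_integrableOn_Ioi (a := 0) (fun y _ => hd y)
      ((hf.integrable_mul_deriv hf).const_mul 2).integrableOn hf.sq.integrableOn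
  have := ht.sqrt
  simp only [Real.sqrt_sq_eq_abs, Real.sqrt_zero] at this
  exact (tendsto_zero_iff_abs_tendsto_zero _).2 this

theorem mul (hf : MemH1 f f') (hg : MemH1 g g') :
    MemH1 (fun x => f x * g x) (fun x => f' x * g x + f x * g' x) where
  hasDerivAt x := (hf.hasDerivAt x).mul (hg.hasDerivAt x)
  sq := by
    refine integrable_sq_of_le (C := ∫ y, (f y ^ 2 + f' y ^ 2))
      (hf.measurable.mul hg.measurable) hg.sq fun x => ?_
    rw [mul_pow]
    exact mul_le_mul_of_nonneg_right (hf.sq_le_integral x) (sq_nonneg _)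
  deriv_sq := by
    have m1 : Measurable fun x => f' x * g x := hf.measurable_deriv.mul hg.measurable
    have m2 : Measurable fun x => f x * g' x := hf.measurable.mul hg.measurable_deriv
    have h1 : Integrable (fun x => (f' x * g x) ^ 2) :=
      integrable_sq_of_le (C := ∫ y, (g y ^ 2 + g' y ^ 2)) m1 hf.deriv_sq fun x => by
        rw [mul_pow, mul_comm]
        exact mul_le_mul_of_nonneg_right (hg.sq_le_integral x) (sq_nonneg _)
    have h2 : Integrable (fun x => (f x * g' x) ^ 2) :=
      integrable_sq_of_le (C := ∫ y, (f y ^ 2 + f' y ^ 2)) m2 hg.deriv_sq fun x => by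
        rw [mul_pow]
        exact mul_le_mul_of_nonneg_right (hf.sq_le_integral x) (sq_nonneg _)
    refine ((h1.add h2).add ((integrable_mul_of_sq m1 m2 h1 h2).const_mul 2)).congr
      (ae_of_all _ fun x => ?_)
    simp only [Pi.add_apply]
    ring

end MemH1

section GroundState

/-- The derivative of the ground state. -/
noncomputable def etaDeriv (x : ℝ) : ℝ := -(1 / 2) * Real.tanh (x / 2) * eta x

theorem eta_eq (x : ℝ) : eta x = 1 / (2 * Real.cosh (x / 2)) := by
  have := (Real.cosh_pos (x / 2)).ne'
  unfold eta
  field_simp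

theorem eta_pos (x : ℝ) : 0 < eta x := by
  have := Real.cosh_pos (x / 2)
  rw [eta_eq]
  positivity

theorem eta_neg (x : ℝ) : eta (-x) = eta x := by
  rw [eta_eq, eta_eq, neg_div, Real.cosh_neg]

theorem tanh_half_sq_add (x : ℝ) : Real.tanh (x / 2) ^ 2 + 4 * eta x ^ 2 = 1 := by
  have h := (Real.cosh_pos (x / 2)).ne'
  rw [Real.tanh_eq_sinh_div_cosh, eta_eq]
  field_simp
  nlinarith [Real.cosh_sq (x / 2)]

theorem eta_le_half (x : ℝ) : eta x ≤ 1 / 2 := by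
  nlinarith [tanh_half_sq_add x, eta_pos x, sq_nonneg (Real.tanh (x / 2))]

theorem hasDerivAt_tanh_half (x : ℝ) :
    HasDerivAt (fun x => Real.tanh (x / 2)) (2 * eta x ^ 2) x := by
  have h := (Real.cosh_pos (x / 2)).ne'
  have hx : HasDerivAt (fun x : ℝ => x / 2) (1 / 2) x := (hasDerivAt_id x).div_const 2
  have h1 := hx.sinh.div hx.cosh h
  refine (h1.congr_of_eventuallyEq (Eventually.of_forall fun y => ?_)).congr_deriv ?_
  · exact Real.tanh_eq_sinh_div_cosh _
  · rw [eta_eq]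
    field_simp
    nlinarith [Real.cosh_sq (x / 2)]

theorem hasDerivAt_eta (x : ℝ) : HasDerivAt eta (etaDeriv x) x := by
  have h := (Real.cosh_pos (x / 2)).ne'
  have hx : HasDerivAt (fun x : ℝ => x / 2) (1 / 2) x := (hasDerivAt_id x).div_const 2
  have h1 := (hx.cosh.inv h).const_mul (1 / 2)
  refine (h1.congr_of_eventuallyEq (Eventually.of_forall fun y => ?_)).congr_deriv ?_
  · simp [eta]
  · rw [etaDeriv, eta_eq, Real.tanh_eq_sinh_div_cosh]
    field_simp

theorem hasDerivAt_etaDeriv (x : ℝ) :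
    HasDerivAt etaDeriv (1 / 4 * eta x - 2 * eta x ^ 3) x := by
  have h := ((hasDerivAt_tanh_half x).const_mul (-(1 / 2))).mul (hasDerivAt_eta x)
  refine h.congr_deriv ?_
  simp only [etaDeriv]
  linear_combination (1 / 4 * eta x) * tanh_half_sq_add x

theorem continuous_eta : Continuous eta :=
  continuous_iff_continuousAt.2 fun x => (hasDerivAt_eta x).continuousAt

theorem continuous_tanh_half : Continuous fun x : ℝ => Real.tanh (x / 2) :=
  continuous_iff_continuousAt.2 fun x => (hasDerivAt_tanh_half x).continuousAt

theorem integrable_eta_sq : Integrable (fun x => eta x ^ 2) := by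
  have h : Integrable (fun x : ℝ => (1 + x ^ 2)⁻¹) := integrable_inv_one_add_sq
  refine h.mono' (continuous_eta.pow 2).aestronglyMeasurable (ae_of_all _ fun x => ?_)
  rw [Real.norm_eq_abs, abs_of_nonneg (sq_nonneg _), eta_eq, div_pow, one_pow, ← one_div]
  refine one_div_le_one_div_of_le (by positivity) ?_
  rw [mul_pow, Real.cosh_sq]
  have : (x / 2) ^ 2 ≤ Real.sinh (x / 2) ^ 2 := by
    rw [sq_le_sq]
    rcases le_total 0 x with hx | hx
    · rw [abs_of_nonneg (by positivity), abs_of_nonneg (Real.sinh_nonneg_iff.2 (by positivity))]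
      exact Real.self_le_sinh_iff.2 (by positivity)
    · rw [abs_of_nonpos (by linarith), abs_of_nonpos (Real.sinh_nonpos_iff.2 (by linarith))]
      exact neg_le_neg (Real.sinh_le_self_iff.2 (by linarith))
  nlinarith

theorem abs_etaDeriv_le (x : ℝ) : |etaDeriv x| ≤ 1 / 2 * eta x := by
  have h := Real.abs_tanh_lt_one (x / 2)
  rw [etaDeriv, abs_mul, abs_mul, abs_of_pos (eta_pos x)]
  have : |-(1 / 2 : ℝ)| = 1 / 2 := by norm_num
  rw [this]
  nlinarith [eta_pos x]

theorem continuous_etaDeriv : Continuous etaDeriv :=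
  continuous_iff_continuousAt.2 fun x => (hasDerivAt_etaDeriv x).continuousAt

theorem memH1_eta : MemH1 eta etaDeriv where
  hasDerivAt := hasDerivAt_eta
  sq := integrable_eta_sq
  deriv_sq := integrable_sq_of_le (C := 1) continuous_etaDeriv.measurable integrable_eta_sq
    fun x => by
      have h := abs_le.1 (abs_etaDeriv_le x)
      nlinarith [eta_pos x]

theorem memH1_etaDeriv : MemH1 etaDeriv (fun x => 1 / 4 * eta x - 2 * eta x ^ 3) where
  hasDerivAt := hasDerivAt_etaDeriv
  sq := memH1_eta.deriv_sq
  deriv_sq := by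
    refine integrable_sq_of_le (C := 1)
      (((continuous_eta.const_mul _).sub ((continuous_eta.pow 3).const_mul _)).measurable)
      integrable_eta_sq fun x => ?_
    have h1 := eta_pos x
    have h2 := eta_le_half x
    have h3 : eta x ^ 2 ≤ 1 / 4 := by nlinarith
    have h4 : (1 / 4 - 2 * eta x ^ 2) ^ 2 ≤ 1 := by nlinarith [sq_nonneg (eta x)]
    calc (1 / 4 * eta x - 2 * eta x ^ 3) ^ 2 = (1 / 4 - 2 * eta x ^ 2) ^ 2 * eta x ^ 2 := by ring
      _ ≤ 1 * eta x ^ 2 := mul_le_mul_of_nonneg_right h4 (sq_nonneg _)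

theorem tendsto_tanh_half_atTop : Tendsto (fun x : ℝ => Real.tanh (x / 2)) atTop (𝓝 1) := by
  have h : Tendsto (fun x => √(1 - 4 * eta x ^ 2)) atTop (𝓝 (√(1 - 4 * 0 ^ 2))) :=
    ((((memH1_eta.tendsto_atTop).pow 2).const_mul 4).const_sub 1).sqrt
  norm_num at h
  refine h.congr' ?_
  filter_upwards [eventually_ge_atTop 0] with x hx
  have h0 : 0 ≤ Real.tanh (x / 2) := by
    rw [Real.tanh_eq_sinh_div_cosh]
    exact div_nonneg (Real.sinh_nonneg_iff.2 (by positivity)) (Real.cosh_pos _).le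
  rw [← Real.sqrt_sq h0]
  congr 1
  linarith [tanh_half_sq_add x]

theorem tendsto_tanh_half_atBot : Tendsto (fun x : ℝ => Real.tanh (x / 2)) atBot (𝓝 (-1)) := by
  have h := (tendsto_tanh_half_atTop.comp tendsto_neg_atBot_atTop).neg
  refine h.congr fun x => ?_
  simp only [Function.comp]
  rw [neg_div, Real.tanh_neg, neg_neg]

theorem integral_eta_sq : ∫ x, eta x ^ 2 = 1 := by
  have h := integral_of_hasDerivAt_of_tendsto hasDerivAt_tanh_half
    (integrable_eta_sq.const_mul 2) tendsto_tanh_half_atBot tendsto_tanh_half_atTop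
  rw [integral_const_mul] at h
  linarith

/-- The weak form of `-(1/2) η'' - η³ = -(1/8) η`. -/
theorem integral_eta_weak {g g' : ℝ → ℝ} (hg : MemH1 g g') :
    ∫ x, (1 / 2 * (etaDeriv x * g' x) - eta x ^ 3 * g x + 1 / 8 * (eta x * g x)) = 0 := by
  have h := memH1_etaDeriv.integral_deriv_mul_add_eq_zero hg
  calc _ = ∫ x, 1 / 2 * ((1 / 4 * eta x - 2 * eta x ^ 3) * g x + etaDeriv x * g' x) := by
        congr 1; ext x; ring
    _ = 0 := by rw [integral_const_mul, h, mul_zero]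

end GroundState

section Coercivity

/-- Pointwise positivity behind the coercivity estimate: here `w, z` stand for a function and twice
its derivative, `X` for the antiderivative `-cosh (x/2) * ∫_x^∞ η w` and `t` for `tanh (x/2)`. -/
theorem calibration_nonneg {t : ℝ} (h0 : 0 ≤ t) (h1 : t ≤ 1) (w z X : ℝ) :
    0 ≤ z ^ 2 + (1 - 6 * (1 - t ^ 2)) * w ^ 2 - w ^ 2 / 32
      - (z * ((-1 - 19 / 4 * t) * w + (-7 / 2 - 4 * t) * X)
        + (1 - t ^ 2) * (-19 / 8 * w ^ 2 - 4 * (w * X) + (-17 / 4 - 8 * t) * X ^ 2)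
        + (-7 / 2 - 4 * t) * (w * (w + t * X))
        + (7 / 4 - 17 / 2 * t - 8 * t ^ 2) * (X * (w + t * X))) := by
  set a : ℝ := 19 / 4 + 13 * t - 129 / 8 * t ^ 2
  set b : ℝ := 4 + 27 / 2 * t - 12 * t ^ 2
  set c : ℝ := 19 / 2 - 6 * t + 2 * t ^ 2 with hc
  have hcpos : 0 < c := by nlinarith
  have hdisc : 0 ≤ 4 * a * c - b ^ 2 := by
    have e : 4 * a * c - b ^ 2 = 329 / 2 * (1 - t) ^ 4 + 930 * (1 - t) ^ 3 * t
        + 830 * (1 - t) ^ 2 * t ^ 2 + 343 * (1 - t) * t ^ 3 + 11 / 2 * t ^ 4 := by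
      simp only [a, b, c]
      ring
    have hs : 0 ≤ 1 - t := by linarith
    rw [e]
    positivity
  have hform : 0 ≤ a * w ^ 2 + b * (w * X) + c * X ^ 2 := by
    have : 0 ≤ c * (a * w ^ 2 + b * (w * X) + c * X ^ 2) := by
      have e : c * (a * w ^ 2 + b * (w * X) + c * X ^ 2)
          = (c * X + b / 2 * w) ^ 2 + (4 * a * c - b ^ 2) / 4 * w ^ 2 := by ring
      rw [e]
      positivity
    exact nonneg_of_mul_nonneg_right this hcpos
  have e : z ^ 2 + (1 - 6 * (1 - t ^ 2)) * w ^ 2 - w ^ 2 / 32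
      - (z * ((-1 - 19 / 4 * t) * w + (-7 / 2 - 4 * t) * X)
        + (1 - t ^ 2) * (-19 / 8 * w ^ 2 - 4 * (w * X) + (-17 / 4 - 8 * t) * X ^ 2)
        + (-7 / 2 - 4 * t) * (w * (w + t * X))
        + (7 / 4 - 17 / 2 * t - 8 * t ^ 2) * (X * (w + t * X)))
      = (z - ((-1 / 2 - 19 / 8 * t) * w + (-7 / 4 - 2 * t) * X)) ^ 2
        + (a * w ^ 2 + b * (w * X) + c * X ^ 2) / 8 := by
    simp only [a, b, c]
    ring
  rw [e]
  positivity

theorem integral_even {f : ℝ → ℝ} (hf : ∀ x, f (-x) = f x) :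
    ∫ x, f x = 2 * ∫ x in Set.Ioi (0 : ℝ), f x := by
  rw [← integral_comp_abs]
  congr 1
  ext x
  rcases abs_choice x with h | h <;> rw [h]
  exact (hf x).symm

theorem half_line_coercivity {w w' : ℝ → ℝ} (hw : MemH1 w w') :
    -14 * (∫ x in Set.Ioi (0 : ℝ), eta x * w x) ^ 2 ≤
      ∫ x in Set.Ioi (0 : ℝ), (4 * w' x ^ 2 + (31 / 32 - 24 * eta x ^ 2) * w x ^ 2) := by
  set I := ∫ x in Set.Ioi (0 : ℝ), eta x * w x
  have hηw : Integrable (fun x => eta x * w x) := memH1_eta.integrable_mul hw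
  set W : ℝ → ℝ := fun x => (∫ y in (0 : ℝ)..x, eta y * w y) - I
  set X : ℝ → ℝ := fun x => Real.cosh (x / 2) * W x
  have hcont : Continuous fun x => eta x * w x := continuous_eta.mul hw.continuous
  have hWd : ∀ x, HasDerivAt W (eta x * w x) x := fun x =>
    (intervalIntegral.integral_hasDerivAt_right (hcont.intervalIntegrable _ _)
      (hcont.stronglyMeasurableAtFilter _ _) hcont.continuousAt).sub_const I
  have hXd : ∀ x, HasDerivAt X ((w x + Real.tanh (x / 2) * X x) / 2) x := fun x => by
    have hx : HasDerivAt (fun x : ℝ => x / 2) (1 / 2) x := (hasDerivAt_id x).div_const 2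
    refine (hx.cosh.mul (hWd x)).congr_deriv ?_
    have := (Real.cosh_pos (x / 2)).ne'
    simp only [X, eta_eq, Real.tanh_eq_sinh_div_cosh]
    field_simp
    ring
  have hXc : Continuous X := continuous_iff_continuousAt.2 fun x => (hXd x).continuousAt
  have hWt : Tendsto W atTop (𝓝 0) := by
    have := (intervalIntegral_tendsto_integral_Ioi 0 hηw.integrableOn tendsto_id).sub_const I
    rwa [sub_self] at this
  have hXt : Tendsto X atTop (𝓝 0) := by
    have hdiv : Tendsto (fun x => eta x * w x / etaDeriv x) atTop (𝓝 0) := by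
      have h := (hw.tendsto_atTop.const_mul (-2)).div tendsto_tanh_half_atTop one_ne_zero
      rw [mul_zero, zero_div] at h
      refine h.congr' ?_
      filter_upwards [tendsto_tanh_half_atTop.eventually_ne one_ne_zero] with x hx
      have := (eta_pos x).ne'
      simp only [etaDeriv, Pi.div_apply]
      field_simp
    have hne : ∀ᶠ x in atTop, etaDeriv x ≠ 0 := by
      filter_upwards [tendsto_tanh_half_atTop.eventually_ne one_ne_zero] with x hx
      exact mul_ne_zero (mul_ne_zero (by norm_num) hx) (eta_pos x).ne'
    have h := (HasDerivAt.lhopital_zero_atTop (Eventually.of_forall hWd)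
      (Eventually.of_forall hasDerivAt_eta) hne hWt memH1_eta.tendsto_atTop hdiv).const_mul (1 / 2)
    rw [mul_zero] at h
    refine h.congr fun x => ?_
    have := (Real.cosh_pos (x / 2)).ne'
    simp only [X, eta_eq]
    field_simp
  set Y : ℝ → ℝ := fun x => (-1 / 2 - 19 / 8 * Real.tanh (x / 2)) * w x ^ 2
    + (-7 / 2 - 4 * Real.tanh (x / 2)) * (w x * X x)
    + (7 / 8 - 17 / 4 * Real.tanh (x / 2) - 4 * Real.tanh (x / 2) ^ 2) * X x ^ 2 with hY
  have hYt : Tendsto Y atTop (𝓝 0) := by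
    have t1 := tendsto_tanh_half_atTop
    have t2 := hw.tendsto_atTop
    have h := ((((t1.const_mul (19 / 8)).const_sub (-1 / 2)).mul (t2.pow 2)).add
      (((t1.const_mul 4).const_sub (-7 / 2)).mul (t2.mul hXt))).add
      ((((t1.const_mul (17 / 4)).const_sub (7 / 8)).sub ((t1.pow 2).const_mul 4)).mul (hXt.pow 2))
    convert h using 2
    norm_num
  set c : ℝ → ℝ := fun x => (-1 - 19 / 4 * Real.tanh (x / 2)) * w x
    + (-7 / 2 - 4 * Real.tanh (x / 2)) * X x with hc
  set d : ℝ → ℝ := fun x => 1 / 2 * ((1 - Real.tanh (x / 2) ^ 2) * (-19 / 8 * w x ^ 2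
      - 4 * (w x * X x) + (-17 / 4 - 8 * Real.tanh (x / 2)) * X x ^ 2)
    + (-7 / 2 - 4 * Real.tanh (x / 2)) * (w x * (w x + Real.tanh (x / 2) * X x))
    + (7 / 4 - 17 / 2 * Real.tanh (x / 2) - 8 * Real.tanh (x / 2) ^ 2)
      * (X x * (w x + Real.tanh (x / 2) * X x))) with hd
  have hYd : ∀ x, HasDerivAt Y (c x * w' x + d x) x := fun x => by
    have t1 := hasDerivAt_tanh_half x
    have t2 := hw.hasDerivAt x
    have h := ((((t1.const_mul (19 / 8)).const_sub (-1 / 2)).mul (t2.pow 2)).add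
      (((t1.const_mul 4).const_sub (-7 / 2)).mul (t2.mul (hXd x)))).add
      ((((t1.const_mul (17 / 4)).const_sub (7 / 8)).sub
        ((t1.pow 2).const_mul 4)).mul ((hXd x).pow 2))
    refine h.congr_deriv ?_
    have e : eta x ^ 2 = (1 - Real.tanh (x / 2) ^ 2) / 4 := by linarith [tanh_half_sq_add x]
    simp only [hc, hd, e, Pi.pow_apply, Pi.mul_apply, Pi.sub_apply]
    push_cast
    ring
  have hcc : Continuous c := by
    have := continuous_tanh_half
    have := hw.continuous
    fun_prop
  have hdc : Continuous d := by
    have := continuous_tanh_half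
    have := hw.continuous
    fun_prop
  have hwi : ∀ T, IntervalIntegrable w' volume 0 T := fun T => by
    have h : IntervalIntegrable (fun x => 1 + w' x ^ 2) volume 0 T :=
      (intervalIntegrable_const).add hw.deriv_sq.intervalIntegrable
    refine h.mono_fun hw.measurable_deriv.aestronglyMeasurable (ae_of_all _ fun x => ?_)
    simp only [Real.norm_eq_abs]
    rw [abs_of_nonneg (by positivity : 0 ≤ 1 + w' x ^ 2), abs_le]
    constructor <;> nlinarith [sq_nonneg (w' x + 1), sq_nonneg (w' x - 1)]
  set F : ℝ → ℝ := fun x => 4 * w' x ^ 2 + (31 / 32 - 24 * eta x ^ 2) * w x ^ 2 with hF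
  have hFi : Integrable F := by
    have h1 := hw.deriv_sq
    have h2 := hw.sq
    have h3 := (memH1_eta.mul hw).sq
    have : F = fun x => 4 * w' x ^ 2 + 31 / 32 * w x ^ 2 - 24 * (eta x * w x) ^ 2 := by
      ext x
      simp only [hF]
      ring
    rw [this]
    exact ((h1.const_mul 4).add (h2.const_mul _)).sub (h3.const_mul _)
  have hineq : ∀ T, 0 ≤ T → 2 * (Y T - Y 0) ≤ ∫ x in (0 : ℝ)..T, F x := fun T hT => by
    have hi : IntervalIntegrable (fun x => c x * w' x + d x) volume 0 T :=
      ((hwi T).continuousOn_mul hcc.continuousOn).add (hdc.intervalIntegrable _ _)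
    rw [← intervalIntegral.integral_eq_sub_of_hasDerivAt (fun x _ => hYd x) hi,
      ← intervalIntegral.integral_const_mul]
    refine intervalIntegral.integral_mono_on hT (hi.const_mul 2) hFi.intervalIntegrable
      fun x hx => ?_
    have ht0 : 0 ≤ Real.tanh (x / 2) := by
      rw [Real.tanh_eq_sinh_div_cosh]
      exact div_nonneg (Real.sinh_nonneg_iff.2 (by linarith [hx.1])) (Real.cosh_pos _).le
    have h := calibration_nonneg ht0 (Real.tanh_lt_one (x / 2)).le (w x) (2 * w' x) (X x)
    have e : eta x ^ 2 = (1 - Real.tanh (x / 2) ^ 2) / 4 := by linarith [tanh_half_sq_add x]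
    simp only [hF, hc, hd, e]
    nlinarith [h]
  have hlim := le_of_tendsto_of_tendsto ((hYt.sub_const (Y 0)).const_mul 2)
    (intervalIntegral_tendsto_integral_Ioi 0 hFi.integrableOn tendsto_id)
    ((eventually_ge_atTop 0).mono hineq)
  refine le_trans ?_ hlim
  have hX0 : X 0 = -I := by simp [X, W]
  have hY0 : Y 0 = -1 / 2 * w 0 ^ 2 + -7 / 2 * (w 0 * X 0) + 7 / 8 * X 0 ^ 2 := by simp [hY]
  rw [hY0, hX0]
  nlinarith [sq_nonneg (w 0 - 7 / 2 * I)]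

/-- Coercivity of the linearized operator `-(1/2) ∂² + 1/8 - 3 η²` on even functions that are
orthogonal to `η`, with the defect of orthogonality on the right-hand side. -/
theorem linearized_coercivity {w w' : ℝ → ℝ} (hw : MemH1 w w') (heven : ∀ x, w (-x) = w x) :
    1 / 640 * (∫ x, (w x ^ 2 + w' x ^ 2)) - (∫ x, eta x * w x) ^ 2 ≤
      ∫ x, (1 / 2 * w' x ^ 2 + 1 / 8 * w x ^ 2 - 3 * (eta x * w x) ^ 2) := by
  have hodd : ∀ x, w' (-x) = -w' x := fun x => by
    have h1 := (hw.hasDerivAt (-x)).comp x (hasDerivAt_neg x)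
    have h2 : HasDerivAt w (w' (-x) * -1) x :=
      h1.congr_of_eventuallyEq (Eventually.of_forall fun y => (heven y).symm)
    linarith [h2.unique (hw.hasDerivAt x)]
  have h := half_line_coercivity hw
  have e1 := integral_even (f := fun x => eta x * w x) fun x => by rw [eta_neg, heven]
  have e2 := integral_even
    (f := fun x => 4 * w' x ^ 2 + (31 / 32 - 24 * eta x ^ 2) * w x ^ 2) fun x => by
      simp only [eta_neg, heven, hodd, neg_sq]
  have i1 := hw.sq
  have i2 := hw.deriv_sq
  have i3 := (memH1_eta.mul hw).sq
  have hmain : -7 * (∫ x, eta x * w x) ^ 2 ≤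
      ∫ x, (4 * w' x ^ 2 + (31 / 32 - 24 * eta x ^ 2) * w x ^ 2) := by
    rw [e1, e2]
    nlinarith
  have hF : ∫ x, (4 * w' x ^ 2 + (31 / 32 - 24 * eta x ^ 2) * w x ^ 2)
      = 4 * (∫ x, w' x ^ 2) + 31 / 32 * (∫ x, w x ^ 2) - 24 * ∫ x, (eta x * w x) ^ 2 := by
    rw [← integral_const_mul, ← integral_const_mul, ← integral_const_mul,
      ← integral_add (by fun_prop) (by fun_prop), ← integral_sub (by fun_prop) (by fun_prop)]
    congr 1
    ext x
    ring
  have hQ : ∫ x, (1 / 2 * w' x ^ 2 + 1 / 8 * w x ^ 2 - 3 * (eta x * w x) ^ 2)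
      = 1 / 2 * (∫ x, w' x ^ 2) + 1 / 8 * (∫ x, w x ^ 2) - 3 * ∫ x, (eta x * w x) ^ 2 := by
    rw [integral_sub (by fun_prop) (by fun_prop), integral_add (by fun_prop) (by fun_prop),
      integral_const_mul, integral_const_mul, integral_const_mul]
  have hle : ∫ x, (eta x * w x) ^ 2 ≤ 1 / 4 * ∫ x, w x ^ 2 := by
    rw [← integral_const_mul]
    refine integral_mono i3 (i1.const_mul _) fun x => ?_
    have h1 := eta_pos x
    have h2 := eta_le_half x
    have h3 : eta x ^ 2 ≤ 1 / 4 := by nlinarith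
    simp only [mul_pow]
    exact mul_le_mul_of_nonneg_right h3 (sq_nonneg _)
  have hp1 : 0 ≤ ∫ x, w x ^ 2 := integral_nonneg fun x => sq_nonneg _
  have hp2 : 0 ≤ ∫ x, w' x ^ 2 := integral_nonneg fun x => sq_nonneg _
  rw [hQ, integral_add i1 i2]
  rw [hF] at hmain
  nlinarith [sq_nonneg (∫ x, eta x * w x)]

end Coercivity

section Profiles

/-- `f` is integrable with integral `I`. -/
structure HasInt (f : ℝ → ℝ) (I : ℝ) : Prop where
  integrable : Integrable f
  integral_eq : ∫ x, f x = I

namespace HasInt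

variable {f g : ℝ → ℝ} {I J : ℝ}

theorem add (hf : HasInt f I) (hg : HasInt g J) : HasInt (fun x => f x + g x) (I + J) :=
  ⟨hf.1.add hg.1, by rw [integral_add hf.1 hg.1, hf.2, hg.2]⟩

theorem sub (hf : HasInt f I) (hg : HasInt g J) : HasInt (fun x => f x - g x) (I - J) :=
  ⟨hf.1.sub hg.1, by rw [integral_sub hf.1 hg.1, hf.2, hg.2]⟩

theorem const_mul (hf : HasInt f I) (c : ℝ) : HasInt (fun x => c * f x) (c * I) :=
  ⟨hf.1.const_mul c, by rw [integral_const_mul, hf.2]⟩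

theorem nonneg (hf : HasInt f I) (h : ∀ x, 0 ≤ f x) : 0 ≤ I :=
  hf.2 ▸ integral_nonneg h

end HasInt

theorem MeasureTheory.Integrable.hasInt {f : ℝ → ℝ} (hf : Integrable f) : HasInt f (∫ x, f x) :=
  ⟨hf, rfl⟩

/-- Squared `H¹` distance of `f` (with derivative `f'`) to the ground state. -/
noncomputable def distSq (f f' : ℝ → ℝ) : ℝ :=
  ∫ x, ((f x - eta x) ^ 2 + (f' x - etaDeriv x) ^ 2)

/-- Density of the excess energy of `η + a` over `η`, for normalized functions. -/
noncomputable def excessDensity (e a b : ℝ) : ℝ :=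
  1 / 4 * b ^ 2 + 1 / 16 * a ^ 2 - 3 / 2 * (e * a) ^ 2 - e * a * (a * a) - 1 / 4 * (a * a) ^ 2

/-- Excess energy `H(f) - H(η)` of a normalized function `f`. -/
noncomputable def excessEnergy (f f' : ℝ → ℝ) : ℝ :=
  ∫ x, excessDensity (eta x) (f x - eta x) (f' x - etaDeriv x)

/-- Normalized even `H¹` functions. -/
structure Profile (f f' : ℝ → ℝ) : Prop where
  memH1 : MemH1 f f'
  even : ∀ x, f (-x) = f x
  normalized : ∫ x, f x ^ 2 = 1

theorem hasInt_eta_sq : HasInt (fun x => eta x ^ 2) 1 := ⟨integrable_eta_sq, integral_eta_sq⟩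

theorem hasInt_eta_weak {g g' : ℝ → ℝ} (hg : MemH1 g g') :
    HasInt (fun x => 1 / 2 * (etaDeriv x * g' x) - eta x ^ 3 * g x + 1 / 8 * (eta x * g x)) 0 := by
  refine ⟨?_, integral_eta_weak hg⟩
  have h1 := memH1_eta.integrable_deriv_mul_deriv hg
  have h2 := memH1_eta.integrable_mul hg
  have h3 : Integrable (fun x => eta x ^ 3 * g x) :=
    ((memH1_eta.mul memH1_eta).integrable_mul (memH1_eta.mul hg)).congr
      (ae_of_all _ fun x => by ring)
  exact ((h1.const_mul _).sub h3).add (h2.const_mul _)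

namespace Profile

variable {f f' : ℝ → ℝ}

theorem hasInt_sq (hf : Profile f f') : HasInt (fun x => f x ^ 2) 1 := ⟨hf.memH1.sq, hf.normalized⟩

theorem sub_eta (hf : Profile f f') :
    MemH1 (fun x => f x - eta x) (fun x => f' x - etaDeriv x) := hf.memH1.sub memH1_eta

theorem hasInt_distSq (hf : Profile f f') :
    HasInt (fun x => (f x - eta x) ^ 2 + (f' x - etaDeriv x) ^ 2) (distSq f f') :=
  (hf.sub_eta.sq.add hf.sub_eta.deriv_sq).hasInt

theorem distSq_nonneg (hf : Profile f f') : 0 ≤ distSq f f' :=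
  hf.hasInt_distSq.nonneg fun x => by positivity

theorem abs_sub_eta_le (hf : Profile f f') {ε : ℝ} (hε : 0 ≤ ε) (hd : distSq f f' ≤ ε ^ 2) (x : ℝ) :
    |f x - eta x| ≤ ε :=
  abs_le_of_sq_le_sq ((hf.sub_eta.sq_le_integral x).trans hd) hε

theorem abs_le_one (hf : Profile f f') {ε : ℝ} (hε : 0 ≤ ε) (hε1 : ε ≤ 1 / 2)
    (hd : distSq f f' ≤ ε ^ 2) (x : ℝ) : |f x| ≤ 1 := by
  have h := abs_le.1 (hf.abs_sub_eta_le hε hd x)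
  rw [abs_le]
  constructor <;> linarith [eta_pos x, eta_le_half x]

theorem hasInt_excess (hf : Profile f f') :
    HasInt (fun x => excessDensity (eta x) (f x - eta x) (f' x - etaDeriv x))
      (excessEnergy f f') := by
  refine Integrable.hasInt ?_
  have hv := hf.sub_eta
  exact (((((hv.deriv_sq.const_mul _).add (hv.sq.const_mul _)).sub
    ((memH1_eta.mul hv).sq.const_mul _)).sub ((memH1_eta.mul hv).integrable_mul (hv.mul hv))).sub
    ((hv.mul hv).sq.const_mul _))

theorem hasInt_quadratic (hf : Profile f f') :
    HasInt (fun x => 1 / 2 * (f' x - etaDeriv x) ^ 2 + 1 / 8 * (f x - eta x) ^ 2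
        - 3 * (eta x * (f x - eta x)) ^ 2)
      (∫ x, (1 / 2 * (f' x - etaDeriv x) ^ 2 + 1 / 8 * (f x - eta x) ^ 2
        - 3 * (eta x * (f x - eta x)) ^ 2)) := by
  refine Integrable.hasInt ?_
  have hv := hf.sub_eta
  exact ((hv.deriv_sq.const_mul _).add (hv.sq.const_mul _)).sub
    ((memH1_eta.mul hv).sq.const_mul _)

/-- The normalization constraint makes `f - η` almost orthogonal to `η`. -/
theorem integral_eta_mul_sub (hf : Profile f f') :
    ∫ x, eta x * (f x - eta x) = -(1 / 2) * ∫ x, (f x - eta x) ^ 2 := by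
  have h := ((hf.hasInt_sq.sub hasInt_eta_sq).sub hf.sub_eta.sq.hasInt).const_mul (1 / 2)
  rw [show -(1 / 2) * ∫ x, (f x - eta x) ^ 2 = 1 / 2 * (1 - 1 - ∫ x, (f x - eta x) ^ 2) by ring,
    ← h.integral_eq]
  congr 1
  ext x
  ring

theorem quadratic_ge (hf : Profile f f') {ε : ℝ} (hd : distSq f f' ≤ ε ^ 2) :
    (1 / 640 - ε ^ 2 / 4) * distSq f f' ≤
      ∫ x, (1 / 2 * (f' x - etaDeriv x) ^ 2 + 1 / 8 * (f x - eta x) ^ 2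
        - 3 * (eta x * (f x - eta x)) ^ 2) := by
  have h := linearized_coercivity hf.sub_eta fun x => by rw [hf.even, eta_neg]
  rw [hf.integral_eta_mul_sub] at h
  change 1 / 640 * distSq f f' - _ ≤ _ at h
  have h0 : 0 ≤ ∫ x, (f x - eta x) ^ 2 := integral_nonneg fun x => sq_nonneg _
  have h1 : ∫ x, (f x - eta x) ^ 2 ≤ distSq f f' :=
    integral_mono hf.sub_eta.sq hf.hasInt_distSq.integrable fun x => by
      simp only [le_add_iff_nonneg_right]
      positivity
  have h2 : (∫ x, (f x - eta x) ^ 2) ^ 2 ≤ ε ^ 2 * distSq f f' := by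
    rw [sq]
    exact mul_le_mul (h1.trans hd) h1 h0 (sq_nonneg _)
  nlinarith

theorem excessEnergy_ge (hf : Profile f f') {ε : ℝ} (hε : 0 ≤ ε) (hε1 : ε ≤ 1 / 10000)
    (hd : distSq f f' ≤ ε ^ 2) : 1 / 2560 * distSq f f' ≤ excessEnergy f f' := by
  have hq := hf.quadratic_ge hd
  have h := ((hf.hasInt_excess.sub (hf.hasInt_quadratic.const_mul (1 / 2))).add
    (hf.hasInt_distSq.const_mul ε)).nonneg fun x => by
    have ha := abs_le.1 (hf.abs_sub_eta_le hε hd x)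
    have he0 := eta_pos x
    have he1 := eta_le_half x
    have key : 0 ≤ ε - eta x * (f x - eta x) - 1 / 4 * (f x - eta x) ^ 2 := by
      nlinarith [mul_nonneg he0.le (sub_nonneg.2 ha.2)]
    have := mul_nonneg key (sq_nonneg (f x - eta x))
    have := mul_nonneg hε (sq_nonneg (f' x - etaDeriv x))
    unfold excessDensity
    linarith
  have hc : 0 ≤ 1 / 2560 - ε ^ 2 / 8 - ε := by nlinarith
  linarith [mul_nonneg hc hf.distSq_nonneg]

theorem excessEnergy_le (hf : Profile f f') {ε : ℝ} (hε : 0 ≤ ε) (hε1 : ε ≤ 1 / 2)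
    (hd : distSq f f' ≤ ε ^ 2) : excessEnergy f f' ≤ distSq f f' := by
  have h := (hf.hasInt_distSq.sub hf.hasInt_excess).nonneg fun x => by
    have ha := abs_le.1 (hf.abs_sub_eta_le hε hd x)
    have he0 := eta_pos x
    have he1 := eta_le_half x
    have key : 0 ≤ 15 / 16 + eta x * (f x - eta x) := by
      nlinarith [mul_nonneg he0.le (by linarith : 0 ≤ f x - eta x + ε)]
    have := mul_nonneg key (sq_nonneg (f x - eta x))
    have := sq_nonneg (f' x - etaDeriv x)
    have := sq_nonneg (eta x * (f x - eta x))
    have := sq_nonneg ((f x - eta x) * (f x - eta x))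
    unfold excessDensity
    linarith
  linarith

end Profile

end Profiles

section GradientSteps

/-- One step `ψ ↦ φ` of the linearly implicit normalized gradient scheme in weak form, where
`1 - τ * m` is the inverse of the norm that is divided out. -/
structure GradientStep (τ m : ℝ) (ψ ψ' φ φ' : ℝ → ℝ) : Prop where
  source : Profile ψ ψ'
  target : Profile φ φ'
  tau_pos : 0 < τ
  factor_pos : 0 < 1 - τ * m
  weak : ∀ g g' : ℝ → ℝ, MemH1 g g' →
    HasInt (fun x => (φ x - ψ x) * g x + τ * (1 / 2 * (φ' x * g' x)
      - ψ x ^ 2 * φ x * g x + m * (ψ x * g x))) 0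

namespace GradientStep

variable {τ m : ℝ} {ψ ψ' φ φ' : ℝ → ℝ}

theorem multiplier_le_one (S : GradientStep τ m ψ ψ' φ φ') (hψ : ∀ x, |ψ x| ≤ 1) : m ≤ 1 := by
  have hψs := S.source.hasInt_sq
  have hφs := S.target.hasInt_sq
  have h := (((S.weak φ φ' S.target.memH1).sub hφs).add
    (((hψs.add hφs).const_mul ((1 - τ * m) / 2)).add (hφs.const_mul τ))).nonneg fun x => by
      have h1 : 0 ≤ 1 - ψ x ^ 2 := by
        rw [← sq_abs]
        nlinarith [abs_nonneg (ψ x), hψ x]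
      have h2 := mul_nonneg S.tau_pos.le (mul_nonneg h1 (sq_nonneg (φ x)))
      have h3 := mul_nonneg S.factor_pos.le (sq_nonneg (ψ x - φ x))
      have h4 := mul_nonneg S.tau_pos.le (sq_nonneg (φ' x))
      linarith
  nlinarith [S.tau_pos]

theorem increment_bound (S : GradientStep τ m ψ ψ' φ φ') (hτ : τ ≤ 1 / 8) (hm : m ≤ 1)
    (hψ : ∀ x, |ψ x| ≤ 1) :
    1 / 2 * (∫ x, (φ x - ψ x) ^ 2) + τ / 4 * (∫ x, (φ' x - ψ' x) ^ 2) ≤ 2 * τ * distSq ψ ψ' := by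
  have hδ := S.target.memH1.sub S.source.memH1
  have h := (((((((S.weak _ _ hδ).sub ((hasInt_eta_weak hδ).const_mul τ)).sub
    ((S.target.hasInt_sq.sub S.source.hasInt_sq).const_mul (τ * (m / 2 - 1 / 16)))).sub
    (hδ.sq.hasInt.const_mul (1 / 2))).sub (hδ.deriv_sq.hasInt.const_mul (τ / 4))).add
    (S.source.hasInt_distSq.const_mul (2 * τ)))).nonneg fun x => by
      have hp := abs_le.1 (hψ x)
      have he0 := eta_pos x
      have he1 := eta_le_half x
      have ht := S.tau_pos
      generalize ψ x = p at *
      generalize ψ' x = p1 at *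
      generalize φ x = f at *
      generalize φ' x = f1 at *
      generalize eta x = e at *
      generalize etaDeriv x = e1 at *
      have hc : |p ^ 2 + p * e + e ^ 2 - 1 / 8| ≤ 25 / 8 := by
        rw [abs_le]
        constructor <;> nlinarith
      have hc2 : (p ^ 2 + p * e + e ^ 2 - 1 / 8) ^ 2 ≤ (25 / 8) ^ 2 :=
        sq_le_sq' (abs_le.1 hc).1 (abs_le.1 hc).2
      set c := p ^ 2 + p * e + e ^ 2 - 1 / 8 with hcd
      have h1 : 0 ≤ 5 / 4 * (f - p) ^ 2 - c * (p - e) * (f - p) + 2 * (p - e) ^ 2 := by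
        nlinarith [sq_nonneg (5 / 2 * (f - p) - c * (p - e)), sq_nonneg (p - e),
          mul_nonneg (sub_nonneg.2 hc2) (sq_nonneg (p - e))]
      have h2 : 0 ≤ 1 / 4 * (f1 - p1) ^ 2 + 1 / 2 * (p1 - e1) * (f1 - p1) + 2 * (p1 - e1) ^ 2 := by
        nlinarith [sq_nonneg ((f1 - p1) + (p1 - e1)), sq_nonneg (p1 - e1)]
      have h3 : 0 ≤ (1 / 2 - τ * (5 / 4 + p ^ 2 + m / 2 - 1 / 16)) * (f - p) ^ 2 := by
        refine mul_nonneg ?_ (sq_nonneg _)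
        have : p ^ 2 ≤ 1 := by nlinarith
        nlinarith
      have h4 := mul_nonneg ht.le h1
      have h5 := mul_nonneg ht.le h2
      rw [hcd] at h4
      linarith
  linarith

theorem distSq_target_le (S : GradientStep τ m ψ ψ' φ φ') (hτ : τ ≤ 1 / 8)
    (hψ : ∀ x, |ψ x| ≤ 1) : distSq φ φ' ≤ 20 * distSq ψ ψ' := by
  have hδ := S.target.memH1.sub S.source.memH1
  have hb := S.increment_bound hτ (S.multiplier_le_one hψ) hψ
  have ht := S.tau_pos
  have hE := S.source.distSq_nonneg
  have hD0 : 0 ≤ ∫ x, (φ x - ψ x) ^ 2 := integral_nonneg fun x => sq_nonneg _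
  have hD1 : 0 ≤ ∫ x, (φ' x - ψ' x) ^ 2 := integral_nonneg fun x => sq_nonneg _
  have h1 : ∫ x, (φ x - ψ x) ^ 2 ≤ 1 / 2 * distSq ψ ψ' := by
    nlinarith [mul_nonneg ht.le hD1, mul_nonneg (sub_nonneg.2 hτ) hE]
  have h2 : ∫ x, (φ' x - ψ' x) ^ 2 ≤ 8 * distSq ψ ψ' := by
    refine le_of_mul_le_mul_left ?_ ht
    linarith
  have h := (((S.source.hasInt_distSq.const_mul 2).add
    ((hδ.sq.hasInt.add hδ.deriv_sq.hasInt).const_mul 2)).sub S.target.hasInt_distSq).nonneg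
      fun x => by
        nlinarith [sq_nonneg ((ψ x - eta x) - (φ x - ψ x)),
          sq_nonneg ((ψ' x - etaDeriv x) - (φ' x - ψ' x))]
  linarith

theorem multiplier_ge (S : GradientStep τ m ψ ψ' φ φ') {ε : ℝ} (hε : 0 < ε) (hε1 : ε ≤ 1 / 4)
    (hψ : distSq ψ ψ' ≤ ε ^ 2) (hφ : distSq φ φ' ≤ ε ^ 2) : 1 / 8 - 3 * ε ≤ m := by
  have hv := S.source.memH1
  have hw := S.target.sub_eta
  have hE := S.source.hasInt_distSq
  have h := (((((S.source.hasInt_sq.const_mul (ε + m)).add (hE.const_mul (1 / ε))).add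
    ((hE.add S.target.hasInt_distSq).const_mul 2)).sub
    ((S.source.hasInt_sq.add S.target.hasInt_sq).const_mul (1 / 16))).const_mul τ |>.sub
    (((S.weak _ _ hv).sub ((hasInt_eta_weak hv).const_mul τ)).sub
      ((hasInt_eta_weak hw).const_mul τ)) |>.add
    ((S.target.hasInt_sq.sub S.source.hasInt_sq).const_mul (1 / 2))).nonneg fun x => by
      have hp := abs_le.1 (S.source.abs_le_one hε.le (by linarith) hψ x)
      have he0 := eta_pos x
      have he1 := eta_le_half x
      have ht := S.tau_pos
      generalize ψ x = p at *
      generalize ψ' x = p1 at *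
      generalize φ x = f at *
      generalize φ' x = f1 at *
      generalize eta x = e at *
      generalize etaDeriv x = e1 at *
      have hi : ε * (1 / ε) = 1 := by field_simp
      have hi0 : 0 < 1 / ε := by positivity
      set j := 1 / ε
      have hc : (e * (p + e)) ^ 2 ≤ 1 ^ 2 := sq_le_sq' (by nlinarith) (by nlinarith)
      have h1 : 0 ≤ ε * p ^ 2 + j * (p - e) ^ 2 + e * (p + e) * p * (p - e) := by
        have : 0 ≤ ε * (ε * p ^ 2 + j * (p - e) ^ 2 + e * (p + e) * p * (p - e)) := by
          have e2 : ε * (ε * p ^ 2 + j * (p - e) ^ 2 + e * (p + e) * p * (p - e))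
              = (ε * p + e * (p + e) * (p - e) / 2) ^ 2
                + (ε * j - (e * (p + e)) ^ 2 / 4) * (p - e) ^ 2 := by ring
          rw [e2, hi]
          have : 0 ≤ 1 - (e * (p + e)) ^ 2 / 4 := by linarith
          positivity
        exact nonneg_of_mul_nonneg_right this hε
      have hc3 : (p ^ 2 + p * e + e ^ 2) ^ 2 ≤ 3 ^ 2 := sq_le_sq' (by nlinarith) (by nlinarith)
      have h2 : 0 ≤ 31 / 16 * ((p - e) ^ 2 + (f - e) ^ 2)
          + (f - e) * (p - e) * (p ^ 2 + p * e + e ^ 2) := by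
        set c := p ^ 2 + p * e + e ^ 2
        nlinarith [sq_nonneg (3 * (p - e) + c * (f - e)),
          mul_nonneg (sub_nonneg.2 hc3) (sq_nonneg (f - e)), sq_nonneg (p - e), sq_nonneg (f - e)]
      have h3 : 0 ≤ 2 * ((p1 - e1) ^ 2 + (f1 - e1) ^ 2) - 1 / 2 * (f1 - e1) * (p1 - e1) := by
        nlinarith [sq_nonneg ((p1 - e1) - (f1 - e1)), sq_nonneg (p1 - e1), sq_nonneg (f1 - e1)]
      have h4 := mul_nonneg ht.le (add_nonneg (add_nonneg h1 h2) h3)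
      have h5 := sq_nonneg (f - p)
      have h6 := mul_nonneg ht.le (mul_nonneg hi0.le (sq_nonneg (p1 - e1)))
      linarith
  have h1 : 1 / ε * distSq ψ ψ' ≤ ε := by
    rw [one_div_mul_eq_div, div_le_iff₀ hε]
    linarith
  have h2 : 0 ≤ τ * (2 * ε + m - 1 / 8 + 4 * ε ^ 2) := by
    nlinarith [mul_nonneg S.tau_pos.le (sub_nonneg.2 h1), mul_nonneg S.tau_pos.le (sub_nonneg.2 hψ),
      mul_nonneg S.tau_pos.le (sub_nonneg.2 hφ)]
  nlinarith [nonneg_of_mul_nonneg_right h2 S.tau_pos]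

theorem energy_decay (S : GradientStep τ m ψ ψ' φ φ') (hτ : τ ≤ 1 / 8) (hm : m ≤ 1)
    (hψ : ∀ x, |ψ x| ≤ 1) :
    1 / 2 * (∫ x, (φ x - ψ x) ^ 2) ≤ τ * (excessEnergy ψ ψ' - excessEnergy φ φ') := by
  have hδ := S.target.memH1.sub S.source.memH1
  have h := ((((((S.source.hasInt_excess.sub S.target.hasInt_excess).sub
    (hasInt_eta_weak hδ)).const_mul τ).add (S.weak _ _ hδ)).add
    ((S.target.hasInt_sq.sub S.source.hasInt_sq).const_mul (τ * (1 / 16 - m / 2)))).sub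
    (hδ.sq.hasInt.const_mul (1 / 2))).nonneg fun x => by
      have hp := abs_le.1 (hψ x)
      have ht := S.tau_pos
      unfold excessDensity
      generalize ψ x = p at *
      generalize ψ' x = p1 at *
      generalize φ x = f at *
      generalize φ' x = f1 at *
      generalize eta x = e at *
      generalize etaDeriv x = e1 at *
      have h1 : 0 ≤ (1 / 2 - τ * (m / 2 + p ^ 2 / 2)) * (f - p) ^ 2 := by
        refine mul_nonneg ?_ (sq_nonneg _)
        have : p ^ 2 ≤ 1 := by nlinarith
        nlinarith
      have h2 := mul_nonneg ht.le (sq_nonneg (f ^ 2 - p ^ 2))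
      have h3 := mul_nonneg ht.le (sq_nonneg (f1 - p1))
      linarith
  linarith

theorem dissipation (S : GradientStep τ m ψ ψ' φ φ') (hτ : τ ≤ 1 / 8) {ε : ℝ} (hε : 0 < ε)
    (hε1 : ε ≤ 1 / 100000) (hψ : distSq ψ ψ' ≤ ε ^ 2) (hφ : distSq φ φ' ≤ ε ^ 2) :
    1 / 3276800 * τ ^ 2 * distSq φ φ' ≤ ∫ x, (φ x - ψ x) ^ 2 := by
  have hδ := S.target.memH1.sub S.source.memH1
  have hw := S.target.sub_eta
  have hm := S.multiplier_ge hε (by linarith) hψ hφ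
  have hs : 0 < τ / 2560 := by have := S.tau_pos; positivity
  have h := (((((S.weak _ _ hw).sub ((hasInt_eta_weak hw).const_mul τ)).sub
    ((S.target.hasInt_sq.sub hasInt_eta_sq).const_mul (τ * (m / 2 - 1 / 16)))).sub
    (S.target.hasInt_quadratic.const_mul τ)).add
    (S.target.hasInt_distSq.const_mul (τ * (4 * ε + 1 / 2560)))).add
    (hδ.sq.hasInt.const_mul (1 / (τ / 2560))) |>.nonneg fun x => by
      have hp := abs_le.1 (S.source.abs_le_one hε.le (by linarith) hψ x)
      have hf := abs_le.1 (S.target.abs_le_one hε.le (by linarith) hφ x)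
      have ha := abs_le.1 (S.target.abs_sub_eta_le hε.le hφ x)
      have he0 := eta_pos x
      have he1 := eta_le_half x
      have ht := S.tau_pos
      have hfac := S.factor_pos
      generalize ψ x = p at *
      generalize ψ' x = p1 at *
      generalize φ x = f at *
      generalize φ' x = f1 at *
      generalize eta x = e at *
      generalize etaDeriv x = e1 at *
      have hfd : |f * (f - p)| ≤ 2 := by
        rw [abs_mul]
        have h1 : |f| ≤ 1 := abs_le.2 hf
        have h2 : |f - p| ≤ 2 := abs_le.2 ⟨by linarith, by linarith⟩
        nlinarith [abs_nonneg f, abs_nonneg (f - p)]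
      have hfd' := abs_le.1 hfd
      have hf2 : f ^ 2 ≤ 1 := by nlinarith
      set K := 1 - τ * m + τ * (2 * f ^ 2 - f * (f - p)) with hK
      have hK2 : K ^ 2 ≤ 2 ^ 2 := by
        refine sq_le_sq' ?_ ?_
        · nlinarith [mul_nonneg ht.le (sq_nonneg f)]
        · nlinarith [mul_nonneg ht.le (by linarith : 0 ≤ m)]
      have hi : τ / 2560 * (1 / (τ / 2560)) = 1 := by field_simp
      have hyoung : 0 ≤ τ / 2560 * (f - e) ^ 2 + K * (f - e) * (f - p)
          + 1 / (τ / 2560) * (f - p) ^ 2 := by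
        set s := τ / 2560
        set j := 1 / s
        have : 0 ≤ s * (s * (f - e) ^ 2 + K * (f - e) * (f - p) + j * (f - p) ^ 2) := by
          have e2 : s * (s * (f - e) ^ 2 + K * (f - e) * (f - p) + j * (f - p) ^ 2)
              = (s * (f - e) + K * (f - p) / 2) ^ 2 + (s * j - K ^ 2 / 4) * (f - p) ^ 2 := by ring
          rw [e2, hi]
          have : 0 ≤ 1 - K ^ 2 / 4 := by linarith
          positivity
        exact nonneg_of_mul_nonneg_right this hs
      have hcub : 0 ≤ 4 * ε + (m / 2 - 1 / 16) - 3 * e * (f - e) - (f - e) ^ 2 := by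
        nlinarith [mul_nonneg he0.le (sub_nonneg.2 ha.2)]
      have h1 := mul_nonneg ht.le (mul_nonneg hcub (sq_nonneg (f - e)))
      have h2 := mul_nonneg (mul_nonneg ht.le (by positivity : 0 ≤ 4 * ε + 1 / 2560))
        (sq_nonneg (f1 - e1))
      rw [hK] at hyoung
      generalize 1 / (τ / 2560) = j at *
      linarith
  have hq := S.target.quadratic_ge hφ
  have hE := S.target.distSq_nonneg
  have hc : 0 ≤ 1 / 640 - ε ^ 2 / 4 - (4 * ε + 1 / 2560) - 1 / 1280 := by nlinarith
  have h1 : τ * (1 / 1280 * distSq φ φ') ≤ 1 / (τ / 2560) * ∫ x, (φ x - ψ x) ^ 2 := by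
    have := mul_le_mul_of_nonneg_left hq S.tau_pos.le
    have := mul_nonneg S.tau_pos.le (mul_nonneg hc hE)
    linarith
  rw [one_div_mul_eq_div (τ / 2560), le_div_iff₀ hs] at h1
  linarith

/-- Near the ground state, a step contracts the excess energy. -/
theorem excessEnergy_contraction (S : GradientStep τ m ψ ψ' φ φ') (hτ : τ ≤ 1 / 8) {ε : ℝ}
    (hε : 0 < ε) (hε1 : ε ≤ 1 / 100000) (hψ : distSq ψ ψ' ≤ ε ^ 2) (hφ : distSq φ φ' ≤ ε ^ 2) :
    (1 + 1 / 6553600 * τ) * excessEnergy φ φ' ≤ excessEnergy ψ ψ' := by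
  have hp := S.source.abs_le_one hε.le (by linarith) hψ
  have h1 := S.energy_decay hτ (S.multiplier_le_one hp) hp
  have h2 := S.dissipation hτ hε hε1 hψ hφ
  have h3 := S.target.excessEnergy_le hε.le (by linarith) hφ
  have ht := S.tau_pos
  have h4 : τ * (1 / 6553600 * τ * distSq φ φ') ≤ τ * (excessEnergy ψ ψ' - excessEnergy φ φ') := by
    linarith
  have h5 := le_of_mul_le_mul_left h4 ht
  have h6 := mul_le_mul_of_nonneg_left h3 (by positivity : 0 ≤ 1 / 6553600 * τ)
  linarith

end GradientStep

end GradientSteps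

section Convergence

theorem gradientStep_of_scheme {τ : ℝ} (hτ : 0 < τ) {ψ ψ' φ φ' χ : ℝ → ℝ} (hψ : Profile ψ ψ')
    (hφ : Profile φ φ') (hχ : MemH1 χ (deriv χ)) (hχ' : MemH1 (deriv χ) (deriv (deriv χ)))
    (heq : ∀ x, χ x = ψ x + τ * (1 / 2 * deriv (deriv χ) x + ψ x ^ 2 * χ x)) {N : ℝ} (hN : 0 < N)
    (hφχ : φ = fun x => χ x / N) :
    GradientStep τ ((1 - 1 / N) / τ) ψ ψ' φ φ' where
  source := hψ
  target := hφ
  tau_pos := hτ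
  factor_pos := by
    rw [mul_div_cancel₀ _ hτ.ne', sub_sub_cancel]
    positivity
  weak g g' hg := by
    have e1 : ∀ x, φ x = 1 / N * χ x := fun x => by rw [hφχ]; ring
    have e2 : φ' = fun x => 1 / N * deriv χ x := by
      rw [← hφ.memH1.deriv_eq, ← (hχ.const_mul (1 / N)).deriv_eq]
      congr 1
      ext x
      exact e1 x
    have h : HasInt (fun x => deriv (deriv χ) x * g x + deriv χ x * g' x) 0 :=
      ⟨(hχ'.integrable_deriv_mul hg).add (hχ'.integrable_mul_deriv hg),
        hχ'.integral_deriv_mul_add_eq_zero hg⟩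
    have h' := h.const_mul (τ / 2 * (1 / N))
    rw [mul_zero] at h'
    convert h' using 1
    ext x
    have hm : τ * ((1 - 1 / N) / τ) = 1 - 1 / N := mul_div_cancel₀ _ hτ.ne'
    rw [e1, e2]
    linear_combination (1 / N * g x) * heq x + (ψ x * g x) * hm

theorem distSq_iterate_le {τ : ℝ} (hτ : τ ≤ 1 / 8) {ψ ψ' : ℕ → ℝ → ℝ} {m : ℕ → ℝ}
    (S : ∀ n, GradientStep τ (m n) (ψ n) (ψ' n) (ψ (n + 1)) (ψ' (n + 1)))
    (h0 : distSq (ψ 0) (ψ' 0) ≤ (1 / 24000000) ^ 2) (n : ℕ) :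
    distSq (ψ n) (ψ' n) ≤ (1 / 100000) ^ 2 / 20 * Real.exp (-(1 / 13107200) * n * τ) := by
  have ht := (S 0).tau_pos
  have hsmall : ∀ n, distSq (ψ n) (ψ' n) ≤ (1 / 100000) ^ 2 / 20 →
      distSq (ψ n) (ψ' n) ≤ (1 / 100000) ^ 2 := fun n h => h.trans (by norm_num)
  have hexp : ∀ n : ℕ, Real.exp (-(1 / 13107200) * n * τ) ≤ 1 := fun n => by
    rw [Real.exp_le_one_iff]
    have : 0 ≤ (n : ℝ) * τ := by positivity
    linarith
  have hcoer : ∀ n, distSq (ψ n) (ψ' n) ≤ (1 / 100000) ^ 2 / 20 →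
      excessEnergy (ψ n) (ψ' n) ≤ (1 / 24000000) ^ 2 * Real.exp (-(1 / 13107200) * n * τ) →
      distSq (ψ n) (ψ' n) ≤ (1 / 100000) ^ 2 / 20 * Real.exp (-(1 / 13107200) * n * τ) :=
    fun n h1 h2 => by
      have := (S n).source.excessEnergy_ge (by norm_num) (by norm_num) (hsmall n h1)
      have := Real.exp_pos (-(1 / 13107200) * n * τ)
      linarith
  suffices h : distSq (ψ n) (ψ' n) ≤ (1 / 100000) ^ 2 / 20 ∧
      excessEnergy (ψ n) (ψ' n) ≤ (1 / 24000000) ^ 2 * Real.exp (-(1 / 13107200) * n * τ) from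
    hcoer n h.1 h.2
  induction n with
  | zero =>
    refine ⟨h0.trans (by norm_num), ?_⟩
    have := (S 0).source.excessEnergy_le (ε := 1 / 100000) (by norm_num) (by norm_num)
      (h0.trans (by norm_num))
    simpa using this.trans h0
  | succ n ih =>
    obtain ⟨h1, h2⟩ := ih
    have hψ := hsmall n h1
    have hφ : distSq (ψ (n + 1)) (ψ' (n + 1)) ≤ (1 / 100000) ^ 2 := by
      have := (S n).distSq_target_le hτ
        ((S n).source.abs_le_one (by norm_num) (by norm_num) hψ)
      linarith
    have hc := (S n).excessEnergy_contraction hτ (by norm_num) le_rfl hψ hφ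
    have hge := (S n).target.excessEnergy_ge (by norm_num) (by norm_num) hφ
    have hE := (S n).target.distSq_nonneg
    have hG : 0 ≤ excessEnergy (ψ (n + 1)) (ψ' (n + 1)) := by linarith
    have hstep : excessEnergy (ψ (n + 1)) (ψ' (n + 1))
        ≤ Real.exp (-(1 / 13107200) * τ) * excessEnergy (ψ n) (ψ' n) := by
      have h3 : 1 ≤ Real.exp (-(1 / 13107200) * τ) * (1 + 1 / 6553600 * τ) := by
        have := Real.add_one_le_exp (-(1 / 13107200) * τ)
        nlinarith
      have := mul_le_mul_of_nonneg_left hc (Real.exp_pos (-(1 / 13107200) * τ)).le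
      have := mul_le_mul_of_nonneg_right h3 hG
      linarith
    have h4 : excessEnergy (ψ (n + 1)) (ψ' (n + 1))
        ≤ (1 / 24000000) ^ 2 * Real.exp (-(1 / 13107200) * (n + 1 : ℕ) * τ) := by
      refine hstep.trans ((mul_le_mul_of_nonneg_left h2 (Real.exp_pos _).le).trans_eq ?_)
      rw [mul_left_comm, ← Real.exp_add]
      congr 2
      push_cast
      ring
    refine ⟨?_, h4⟩
    have := hexp (n + 1)
    linarith

theorem H1sq_sub_eta {f f' : ℝ → ℝ} (hf : Profile f f') :
    H1sq (fun x => f x - eta x) = distSq f f' := by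
  rw [H1sq, hf.sub_eta.deriv_eq, distSq]

end Convergence

/-- main semi-discrete convergence theorem (Theorem 4.2): there are
`R, τ₀, r, C > 0` such that for `0 < τ ≤ τ₀`, any sequence produced by the linearly implicit
normalized gradient scheme starting `R`-close to `η` in `H¹` converges exponentially:
`‖ψ_n − η‖_{H¹} ≤ C e^{−rnτ}`. -/
theorem semidiscrete_scheme_converges :
    ∃ R τ₀ r C : ℝ, 0 < R ∧ 0 < τ₀ ∧ 0 < r ∧ 0 < C ∧
      ∀ τ : ℝ, 0 < τ → τ ≤ τ₀ →
      ∀ ψ ψs : ℕ → ℝ → ℝ,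
        (∀ n : ℕ, ∀ x : ℝ, ψ n (-x) = ψ n x) →
        (∀ n : ℕ, Differentiable ℝ (ψ n)) →
        (∀ n : ℕ, Integrable (fun x => (ψ n x)^2)) →
        (∀ n : ℕ, Integrable (fun x => (deriv (ψ n) x)^2)) →
        (∀ n : ℕ, (∫ x : ℝ, (ψ n x)^2) = 1) →
        (∀ n : ℕ, ∀ x : ℝ, ψs n (-x) = ψs n x) →
        (∀ n : ℕ, Differentiable ℝ (ψs n) ∧ Differentiable ℝ (deriv (ψs n))) →
        (∀ n : ℕ, Integrable (fun x => (ψs n x)^2) ∧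
          Integrable (fun x => (deriv (ψs n) x)^2) ∧
          Integrable (fun x => (deriv (deriv (ψs n)) x)^2)) →
        (∀ n : ℕ, ∀ x : ℝ, ψs n x =
          ψ n x + τ * ((1/2) * deriv (deriv (ψs n)) x + (ψ n x)^2 * ψs n x)) →
        (∀ n : ℕ, 0 < Real.sqrt (∫ x : ℝ, (ψs n x)^2)) →
        (∀ n : ℕ, ψ (n+1) = fun x => ψs n x / Real.sqrt (∫ y : ℝ, (ψs n y)^2)) →
        Real.sqrt (H1sq (fun x => ψ 0 x - eta x)) ≤ R →
        ∀ n : ℕ, Real.sqrt (H1sq (fun x => ψ n x - eta x)) ≤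
          C * Real.exp (-r * n * τ) := by
  refine ⟨1 / 24000000, 1 / 8, 1 / 26214400, 1, by norm_num, by norm_num, by norm_num, by norm_num,
    ?_⟩
  intro τ hτ hτ1 ψ χ heven hdiff hsq hdsq hnorm _ hχdiff hχsq heq hN hstep h0 n
  have hprof : ∀ n, Profile (ψ n) (deriv (ψ n)) := fun n =>
    ⟨⟨fun x => (hdiff n x).hasDerivAt, hsq n, hdsq n⟩, heven n, hnorm n⟩
  have S := fun n => gradientStep_of_scheme hτ (hprof n) (hprof (n + 1))
    ⟨fun x => ((hχdiff n).1 x).hasDerivAt, (hχsq n).1, (hχsq n).2.1⟩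
    ⟨fun x => ((hχdiff n).2 x).hasDerivAt, (hχsq n).2.1, (hχsq n).2.2⟩ (heq n) (hN n) (hstep n)
  rw [H1sq_sub_eta (hprof 0), Real.sqrt_le_left (by norm_num)] at h0
  have h := distSq_iterate_le hτ1 S h0 n
  rw [H1sq_sub_eta (hprof n), Real.sqrt_le_left (by positivity), one_mul, ← Real.exp_nat_mul]
  refine h.trans ?_
  have he : Real.exp (-(1 / 13107200) * n * τ)
      = Real.exp ((2 : ℕ) * (-(1 / 26214400) * n * τ)) := by
    congr 1
    push_cast
    ring
  rw [he]
  have := Real.exp_pos ((2 : ℕ) * (-(1 / 26214400) * n * τ))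
  linarith
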